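/- arXiv:1805.05025 — 2 statements merged into one kernel-verified Lean document; each statement's English description precedes it below -/
import Mathlib

section
/- Fix σ_* ∈ S and a constant 0 < δ ≤ 1/(2Q²), and assume (1−δ)·n/Q² is an integer. Let (σ_t)_{t≥0} and (σ̃_t)_{t≥0} be two product replacement chains started at σ and σ̃ respectively, and set D_t := (1/2)·Σ_{a,b∈G} |n^{σ_*}_{a,b}(σ_t) − n^{σ_*}_{a,b}(σ̃_t)|. Then there exists a coupling (σ_t, σ̃_t)_{t≥0} of the two chains such that, on the event that both (n^{σ_*}_{a,b}(σ_t))_{a,b∈G} ∈ M_δ and (n^{σ_*}_{a,b}(σ̃_t))_{a,b∈G} ∈ M_δ and D_t > 0, one has E[D_{t+1} − D_t | σ_t, σ̃_t] ≤ 0 and Pr(D_{t+1} − D_t ≠ 0 | σ_t, σ̃_t) ≥ (1−δ)²/(4Q³). -/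
open scoped BigOperators
open Filter

attribute [local instance] Classical.propDecidable

noncomputable section

namespace PR

variable (G : Type) [Group G] [Fintype G]

/-- A configuration: an `n`-tuple of elements of `G`. -/
abbrev Config (n : ℕ) := Fin n → G

/-- The set of generating `n`-tuples. -/
def gens (n : ℕ) : Set (Config G n) :=
  {σ | Subgroup.closure (Set.range σ) = ⊤}

/-- A move of the product replacement chain: an ordered pair of distinct indices
together with a sign (`true` = multiply, `false` = multiply by inverse). -/
abbrev Move (n : ℕ) := {p : Fin n × Fin n // p.1 ≠ p.2} × Bool

/-- Applying a move: replace `σ i` by `σ i * (σ j)^{±1}`. -/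
def applyMove {n : ℕ} (σ : Config G n) (m : Move n) : Config G n :=
  Function.update σ m.1.1.1
    (σ m.1.1.1 * (if m.2 then σ m.1.1.2 else (σ m.1.1.2)⁻¹))

/-- One-step transition probability of the product replacement chain. -/
def step {n : ℕ} (σ σ' : Config G n) : ℝ :=
  ((Finset.univ.filter (fun m : Move n => applyMove G σ m = σ')).card : ℝ) /
    (Fintype.card (Move n) : ℝ)

/-- The law of `σ_t` for the chain started at `σ₀`. -/
def law {n : ℕ} (σ₀ : Config G n) : ℕ → Config G n → ℝ
  | 0 => fun σ' => if σ' = σ₀ then 1 else 0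
  | (t + 1) => fun σ' => ∑ τ : Config G n, law σ₀ t τ * step G τ σ'

/-- Probability that `σ_t ∈ E` for the chain started at `σ₀`. -/
def prob {n : ℕ} (σ₀ : Config G n) (t : ℕ) (E : Set (Config G n)) : ℝ :=
  ∑ τ ∈ Finset.univ.filter (fun τ => τ ∈ E), law G σ₀ t τ

/-- Probability of a trajectory event for the chain started at `σ₀`, over the
time horizon `{0, 1, …, T}`. -/
def pathProb {n : ℕ} (σ₀ : Config G n) (T : ℕ)
    (E : Set (Fin (T + 1) → Config G n)) : ℝ :=
  ∑ p ∈ Finset.univ.filter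
      (fun p : Fin (T + 1) → Config G n => p 0 = σ₀ ∧ p ∈ E),
    ∏ t : Fin T, step G (p t.castSucc) (p t.succ)

/-- `n_a(σ)`: the number of sites holding the group element `a`. -/
def nCount {n : ℕ} (σ : Config G n) (a : G) : ℕ :=
  (Finset.univ.filter (fun i => σ i = a)).card

/-- `n^H_non(σ)`: the number of sites whose element lies outside `H`. -/
def nNon {n : ℕ} (H : Subgroup G) (σ : Config G n) : ℕ :=
  (Finset.univ.filter (fun i => σ i ∉ H)).card

/-- `n^{id}_non(σ)`: the number of sites not holding the identity. -/
def nNonId {n : ℕ} (σ : Config G n) : ℕ :=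
  (Finset.univ.filter (fun i => σ i ≠ 1)).card

/-- `S_non(c)`. -/
def SNon (n : ℕ) (c : ℝ) : Set (Config G n) :=
  {σ | σ ∈ gens G n ∧
    ∀ H : Subgroup G, H ≠ ⊤ → c * n ≤ (nNon G H σ : ℝ)}

/-- The `δ`-typical set `S_*(δ)`. -/
def SAst (n : ℕ) (δ : ℝ) : Set (Config G n) :=
  {σ | σ ∈ gens G n ∧
    Real.sqrt (∑ a : G, ((nCount G σ a : ℝ) / n - 1 / (Fintype.card G : ℝ)) ^ 2) ≤ δ}

/-- `n^{σ₀}_{a,b}(σ)`. -/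
def nab {n : ℕ} (σ₀ σ : Config G n) (a b : G) : ℕ :=
  (Finset.univ.filter (fun i => σ₀ i = a ∧ σ i = b)).card

/-- `S_*(σ₀, r)`. -/
def SAstM {n : ℕ} (σ₀ : Config G n) (r : ℝ) : Set (Config G n) :=
  {σ | σ ∈ gens G n ∧
    ∀ a : G, Real.sqrt (∑ b : G,
      ((nab G σ₀ σ a b : ℝ) / (nCount G σ₀ a : ℝ) - 1 / (Fintype.card G : ℝ)) ^ 2) ≤ r}

/-- The uniform stationary distribution `π` on the set of generating tuples. -/
def statDist (n : ℕ) : Config G n → ℝ := fun σ =>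
  if σ ∈ gens G n then
    1 / ((Finset.univ.filter (fun τ : Config G n => τ ∈ gens G n)).card : ℝ)
  else 0

/-- Total-variation distance between two (finitely supported) signed weights,
as the supremum over finite sets `A` of `|p(A) - q(A)|`. -/
def tvDist {α : Type*} (p q : α → ℝ) : ℝ :=
  sSup {x : ℝ | ∃ A : Finset α, x = |∑ a ∈ A, p a - ∑ a ∈ A, q a|}

/-- `d_σ(t) = max_{A ⊆ S} |P_σ(σ_t ∈ A) - π(A)|`. -/
def dTV {n : ℕ} (σ : Config G n) (t : ℕ) : ℝ :=
  sSup {x : ℝ | ∃ A : Finset (Config G n), ↑A ⊆ gens G n ∧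
    x = |∑ τ ∈ A, law G σ t τ - ∑ τ ∈ A, statDist G n τ|}

/-- `max_{σ ∈ S} d_σ(t)`. -/
def dMax (n : ℕ) (t : ℕ) : ℝ :=
  sSup {x : ℝ | ∃ σ ∈ gens G n, x = dTV G σ t}

end PR

namespace PR

variable (G : Type) [Group G] [Fintype G]

/-- A (Markovian) coupling kernel for two copies of the product replacement chain:
a transition kernel on pairs of configurations, both of whose marginals are the
one-step transition probabilities of the product replacement chain. -/
def IsCouplingKernel {n : ℕ}
    (K : Config G n × Config G n → Config G n × Config G n → ℝ) : Prop :=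
  (∀ p q, 0 ≤ K p q) ∧
  (∀ p s', (∑ st' : Config G n, K p (s', st')) = step G p.1 s') ∧
  (∀ p st', (∑ s' : Config G n, K p (s', st')) = step G p.2 st')

/-- Probability of a trajectory event for the coupled chain driven by the kernel `K`,
started at the pair `start`, over the time horizon `{0, 1, …, T}`. -/
def jointPathProb {n : ℕ}
    (K : Config G n × Config G n → Config G n × Config G n → ℝ)
    (start : Config G n × Config G n) (T : ℕ)
    (E : Set (Fin (T + 1) → Config G n × Config G n)) : ℝ :=
  ∑ p ∈ Finset.univ.filter
      (fun p : Fin (T + 1) → Config G n × Config G n => p 0 = start ∧ p ∈ E),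
    ∏ t : Fin T, K (p t.castSucc) (p t.succ)

end PR

namespace PR

variable (G : Type) [Group G] [Fintype G]

/-- The set `M_δ` of proportion matrices with all entries at least `(1−δ)n/Q²` and
total sum `n`. -/
def MSet (n : ℕ) (δ : ℝ) : Set (G → G → ℕ) :=
  {N | (∀ a b : G, (1 - δ) * n / (Fintype.card G : ℝ) ^ 2 ≤ (N a b : ℝ)) ∧
    (∑ a : G, ∑ b : G, N a b) = n}

/-- `D(s, st) = (1/2) Σ_{a,b} |n^{σ_*}_{a,b}(s) − n^{σ_*}_{a,b}(st)|`. -/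
def Dfun {n : ℕ} (σast s st : Config G n) : ℝ :=
  (1 / 2) * ∑ a : G, ∑ b : G, |(nab G σast s a b : ℝ) - (nab G σast st a b : ℝ)|

end PR

namespace PR

section Imbalance

variable {α : Type*} [Fintype α]

/-- The `ℓ¹`-norm of an integer vector. -/
def l1 (d : α → ℤ) : ℤ := ∑ c, |d c|

lemma sum_abs_second_difference_le (d : α → ℤ) {c₀ : α} (h : d c₀ ≠ 0) :
    ∑ c, ((|d c + 1| - |d c|) + (|d c - 1| - |d c|)) ≤ 2 * ((Fintype.card α : ℤ) - 1) := by
  calc ∑ c, ((|d c + 1| - |d c|) + (|d c - 1| - |d c|))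
      ≤ ∑ c, ((2 : ℤ) + Pi.single (M := fun _ : α => ℤ) c₀ (-2) c) := by
        refine Finset.sum_le_sum fun c _ => ?_
        by_cases hc : c = c₀
        · subst hc
          simp
          grind
        · simp [Pi.single_eq_of_ne hc]
          grind
    _ = 2 * ((Fintype.card α : ℤ) - 1) := by
        rw [Finset.sum_add_distrib]
        simp
        ring

variable [DecidableEq α]

lemma l1_add_single (d : α → ℤ) (u : α) (z : ℤ) :
    l1 (d + Pi.single u z) = l1 d + (|d u + z| - |d u|) := by
  have h : l1 (d + Pi.single u z) - l1 d = |d u + z| - |d u| := by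
    unfold l1
    rw [← Finset.sum_sub_distrib, Finset.sum_eq_single u]
    · simp
    · intro c _ hc
      simp [Pi.single_eq_of_ne hc]
    · simp
  linarith

lemma l1_transfer_le (d : α → ℤ) (u v : α) :
    l1 (d + Pi.single u 1 + Pi.single v (-1)) ≤
      l1 d + (|d u + 1| - |d u|) + (|d v - 1| - |d v|) := by
  rw [l1_add_single, l1_add_single]
  by_cases h : v = u
  · subst h
    simp
    grind
  · simp [Pi.single_eq_of_ne h]
    grind

lemma l1_transfer_le_two (d : α → ℤ) (u v : α) :
    l1 (d + Pi.single u 1 + Pi.single v (-1)) ≤ l1 d + 2 := by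
  have := l1_transfer_le d u v
  grind

lemma l1_transfer_of_neg_of_pos (d : α → ℤ) {u v : α} (hu : d u < 0) (hv : 0 < d v) :
    l1 (d + Pi.single u 1 + Pi.single v (-1)) = l1 d - 2 := by
  have h : v ≠ u := by rintro rfl; omega
  rw [l1_add_single, l1_add_single]
  simp [Pi.single_eq_of_ne h]
  grind

lemma l1_transfer_of_pos_of_neg (d : α → ℤ) {u v : α} (hu : 0 < d u) (hv : d v < 0) :
    l1 (d + Pi.single u 1 + Pi.single v (-1)) = l1 d + 2 := by
  have h : v ≠ u := by rintro rfl; omega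
  rw [l1_add_single, l1_add_single]
  simp [Pi.single_eq_of_ne h]
  grind

end Imbalance

section Matching

variable {I A B : Type*} [Fintype I]

/-- Two labellings of a finite set can be matched by a permutation respecting `r` so that
unmatched sites carry labels that are in strict excess on their own side. -/
lemma exists_matching (r : I → A) (f g : I → B) :
    ∃ φ : Equiv.Perm I, (∀ i, r (φ i) = r i) ∧ ∀ i, f i ≠ g (φ i) →
      (Finset.univ.filter fun j => r j = r i ∧ g j = f i).card <
        (Finset.univ.filter fun j => r j = r i ∧ f j = f i).card ∧
      (Finset.univ.filter fun j => r j = r i ∧ f j = g (φ i)).card <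
        (Finset.univ.filter fun j => r j = r i ∧ g j = g (φ i)).card := by
  let P := {φ : Equiv.Perm I // ∀ i, r (φ i) = r i}
  have : Nonempty P := ⟨⟨1, fun _ => rfl⟩⟩
  obtain ⟨⟨φ, hφ⟩, hmax⟩ := Finite.exists_max
    fun φ : P => (Finset.univ.filter fun i => f i = g (φ.1 i)).card
  have no_swap : ∀ i j, r i = r j → f i ≠ g (φ i) → f j ≠ g (φ j) → f i ≠ g (φ j) := by
    intro i j hr hi hj hij
    have hP : ∀ x, r ((φ * Equiv.swap i j) x) = r x := by
      intro x
      rw [Equiv.Perm.mul_apply, hφ]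
      rcases eq_or_ne x i with rfl | hxi
      · simp [hr]
      rcases eq_or_ne x j with rfl | hxj
      · simp [hr]
      rw [Equiv.swap_apply_of_ne_of_ne hxi hxj]
    refine (hmax ⟨φ * Equiv.swap i j, hP⟩).not_gt (Finset.card_lt_card ?_)
    rw [Finset.ssubset_iff_of_subset]
    · exact ⟨i, Finset.mem_filter.2 ⟨Finset.mem_univ _, by simp [hij]⟩, by simpa using hi⟩
    · intro x hx
      simp only [Finset.mem_filter, Finset.mem_univ, true_and] at hx ⊢
      have hxi : x ≠ i := by rintro rfl; exact hi hx
      have hxj : x ≠ j := by rintro rfl; exact hj hx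
      rw [Equiv.Perm.mul_apply, Equiv.swap_apply_of_ne_of_ne hxi hxj, hx]
  refine ⟨φ, hφ, fun i hi => ⟨?_, ?_⟩⟩
  · rw [← Finset.card_map φ.symm.toEmbedding]
    refine Finset.card_lt_card ?_
    rw [Finset.ssubset_iff_of_subset]
    · refine ⟨i, by simp, ?_⟩
      simp [hφ, Ne.symm hi]
    · intro j hj
      simp only [Finset.mem_map_equiv, Equiv.symm_symm, Finset.mem_filter, Finset.mem_univ,
        true_and, hφ] at hj ⊢
      refine ⟨hj.1, ?_⟩
      by_contra hne
      exact no_swap i j hj.1.symm hi (fun h => hne (h.trans hj.2)) hj.2.symm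
  · rw [← Finset.card_map φ.toEmbedding]
    refine Finset.card_lt_card ?_
    rw [Finset.ssubset_iff_of_subset]
    · refine ⟨φ i, by simp [hφ], ?_⟩
      simp [hi]
    · intro j hj
      simp only [Finset.mem_map_equiv, Finset.mem_filter, Finset.mem_univ, true_and] at hj ⊢
      have hrj : r (φ.symm j) = r j := by simpa using (hφ (φ.symm j)).symm
      refine ⟨hrj ▸ hj.1, ?_⟩
      by_contra hne
      refine no_swap (φ.symm j) i hj.1 ?_ hi hj.2
      rw [Equiv.apply_symm_apply, hj.2]
      exact Ne.symm hne

end Matching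

section Kernel

variable {G : Type} [Group G] [Fintype G] {n : ℕ}

/-- The kernel moving the first configuration by a uniform move `m` and the second by the
move `Φ p m`. -/
def moveKernel (Φ : Config G n × Config G n → Equiv.Perm (Move n))
    (p q : Config G n × Config G n) : ℝ :=
  ((Finset.univ.filter fun m : Move n =>
    (applyMove G p.1 m, applyMove G p.2 (Φ p m)) = q).card : ℝ) / (Fintype.card (Move n) : ℝ)

lemma sum_moveKernel_mul (Φ : Config G n × Config G n → Equiv.Perm (Move n))
    (p : Config G n × Config G n) (f : Config G n × Config G n → ℝ) :
    ∑ q, moveKernel Φ p q * f q =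
      (∑ m, f (applyMove G p.1 m, applyMove G p.2 (Φ p m))) / (Fintype.card (Move n) : ℝ) := by
  rw [← Finset.sum_fiberwise Finset.univ
    (fun m => (applyMove G p.1 m, applyMove G p.2 (Φ p m))), Finset.sum_div]
  refine Finset.sum_congr rfl fun q _ => ?_
  have h : ∀ m ∈ Finset.univ.filter (fun m : Move n =>
      (applyMove G p.1 m, applyMove G p.2 (Φ p m)) = q),
      f (applyMove G p.1 m, applyMove G p.2 (Φ p m)) = f q := by
    intro m hm
    rw [(Finset.mem_filter.1 hm).2]
  rw [Finset.sum_congr rfl h, Finset.sum_const, nsmul_eq_mul, moveKernel]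
  ring

lemma sum_filter_moveKernel (Φ : Config G n × Config G n → Equiv.Perm (Move n))
    (p : Config G n × Config G n) (P : Config G n × Config G n → Prop)
    [DecidablePred P] :
    ∑ q ∈ Finset.univ.filter P, moveKernel Φ p q =
      ((Finset.univ.filter fun m : Move n =>
        P (applyMove G p.1 m, applyMove G p.2 (Φ p m))).card : ℝ) /
          (Fintype.card (Move n) : ℝ) := by
  have h := sum_moveKernel_mul Φ p (fun q => if P q then 1 else 0)
  simp only [mul_ite, mul_one, mul_zero, Finset.sum_boole] at h
  rw [Finset.sum_filter, h]

lemma isCouplingKernel_moveKernel (Φ : Config G n × Config G n → Equiv.Perm (Move n)) :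
    IsCouplingKernel G (moveKernel Φ) := by
  refine ⟨fun p q => by unfold moveKernel; positivity, fun p s' => ?_, fun p st' => ?_⟩
  · have h := sum_moveKernel_mul Φ p (fun q => if q.1 = s' then 1 else 0)
    simp only [mul_ite, mul_one, mul_zero, Finset.sum_boole] at h
    rw [step, ← h, Fintype.sum_prod_type_right]
    simp
  · have h := sum_moveKernel_mul Φ p (fun q => if q.2 = st' then 1 else 0)
    simp only [mul_ite, mul_one, mul_zero, Finset.sum_boole] at h
    have hcard : (Finset.univ.filter fun m : Move n => applyMove G p.2 (Φ p m) = st').card =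
        (Finset.univ.filter fun m : Move n => applyMove G p.2 m = st').card :=
      Finset.card_equiv (Φ p) (by simp)
    rw [step, ← hcard, ← h, Fintype.sum_prod_type]
    simp

end Kernel

section Moves

variable {n : ℕ}

/-- The move obtained from `(i, j, ε)` by first sending `j` to `ρ i ε j` and then transporting
both indices along `φ`. -/
def relabelMove (φ : Equiv.Perm (Fin n)) (ρ : Fin n → Bool → Equiv.Perm (Fin n))
    (hρ : ∀ i ε, ρ i ε i = i) (m : Move n) : Move n :=
  (⟨(φ m.1.1.1, φ (ρ m.1.1.1 m.2 m.1.1.2)), fun h => m.1.2 <| by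
    have h' := φ.injective h
    exact (ρ m.1.1.1 m.2).injective ((hρ _ _).trans h')⟩, m.2)

lemma relabelMove_injective (φ : Equiv.Perm (Fin n)) (ρ : Fin n → Bool → Equiv.Perm (Fin n))
    (hρ : ∀ i ε, ρ i ε i = i) : Function.Injective (relabelMove φ ρ hρ) := by
  rintro ⟨⟨⟨i, j⟩, hij⟩, ε⟩ ⟨⟨⟨i', j'⟩, hij'⟩, ε'⟩ h
  simp only [relabelMove, Prod.mk.injEq, Subtype.mk.injEq, EmbeddingLike.apply_eq_iff_eq] at h
  obtain ⟨⟨rfl, h⟩, rfl⟩ := h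
  have := (ρ i ε).injective h
  subst this
  rfl

lemma sum_move (F : Fin n → Fin n → Bool → ℤ) :
    ∑ m : Move n, F m.1.1.1 m.1.1.2 m.2 =
      ∑ ε, ∑ i, ∑ j, if i = j then 0 else F i j ε := by
  rw [Fintype.sum_prod_type_right]
  refine Finset.sum_congr rfl fun ε _ => ?_
  rw [← Finset.sum_subtype (Finset.univ.filter fun p : Fin n × Fin n => p.1 ≠ p.2) (by simp)
    (fun p => F p.1 p.2 ε), Finset.sum_filter, Fintype.sum_prod_type]
  simp only [ne_eq, ite_not]

lemma card_move_le : Fintype.card (Move n) ≤ n * n * 2 := by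
  calc Fintype.card (Move n) ≤ Fintype.card ((Fin n × Fin n) × Bool) :=
        Fintype.card_le_of_injective (fun m => (m.1.1, m.2)) (by
          rintro ⟨⟨p, hp⟩, ε⟩ ⟨⟨q, hq⟩, ε'⟩ h
          simpa using h)
    _ = n * n * 2 := by simp

end Moves

section Counts

variable {G : Type} [Group G] {n : ℕ}

/-- The signed difference of the type counts of two configurations. -/
def imbalance (σast s st : Config G n) (c : G × G) : ℤ :=
  (nab G σast s c.1 c.2 : ℤ) - (nab G σast st c.1 c.2 : ℤ)

/-- The factor by which the move with sign `ε` and source value `g` multiplies. -/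
def signed (ε : Bool) (g : G) : G := if ε then g else g⁻¹

lemma nab_applyMove (σast s : Config G n) (m : Move n) (c : G × G) :
    (nab G σast (applyMove G s m) c.1 c.2 : ℤ) = nab G σast s c.1 c.2 +
      ((Pi.single (σast m.1.1.1, s m.1.1.1 * signed m.2 (s m.1.1.2)) 1 : G × G → ℤ) c +
        (Pi.single (σast m.1.1.1, s m.1.1.1) (-1) : G × G → ℤ) c) := by
  obtain ⟨⟨⟨i, j⟩, hij⟩, ε⟩ := m
  obtain ⟨a, b⟩ := c
  simp only [nab, Finset.card_filter, Nat.cast_sum]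
  rw [← sub_eq_iff_eq_add', ← Finset.sum_sub_distrib, Finset.sum_eq_single i]
  · simp [applyMove, signed, Pi.single_apply, Prod.ext_iff, eq_comm]
    split_ifs <;> simp_all
  · intro x _ hx
    simp [applyMove, Function.update_of_ne hx]
  · simp

lemma two_mul_Dfun {G : Type} [Fintype G] {n : ℕ} (σast s st : Config G n) :
    2 * Dfun G σast s st = (l1 (imbalance σast s st) : ℝ) := by
  simp [Dfun, l1, imbalance, Fintype.sum_prod_type]

lemma imbalance_applyMove (σast s st : Config G n) (m m' : Move n)
    (h : σast m'.1.1.1 = σast m.1.1.1) :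
    imbalance σast (applyMove G s m) (applyMove G st m') = imbalance σast s st +
      Pi.single (σast m.1.1.1, s m.1.1.1 * signed m.2 (s m.1.1.2)) 1 +
      Pi.single (σast m.1.1.1, s m.1.1.1) (-1) +
      Pi.single (σast m.1.1.1, st m'.1.1.1) 1 +
      Pi.single (σast m.1.1.1, st m'.1.1.1 * signed m'.2 (st m'.1.1.2)) (-1) := by
  funext c
  simp only [imbalance, nab_applyMove, Pi.add_apply, h, Pi.single_neg, Pi.neg_apply]
  ring

end Counts

section Change

variable {α : Type*} [Fintype α] [DecidableEq α]

/-- The increment of the `ℓ¹`-norm when one chain moves a site from `u` to `v` and the other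
chain moves a site from `u'` to `v'`. -/
def increment (d : α → ℤ) (u v u' v' : α) : ℤ :=
  l1 (d + Pi.single v 1 + Pi.single u (-1) + Pi.single u' 1 + Pi.single v' (-1)) - l1 d

lemma increment_source_eq (d : α → ℤ) (u v v' : α) :
    increment d u v u v' = l1 (d + Pi.single v 1 + Pi.single v' (-1)) - l1 d := by
  have h : d + Pi.single v 1 + Pi.single u (-1) + Pi.single u 1 + Pi.single v' (-1) =
      d + Pi.single v 1 + Pi.single v' (-1) := by
    simp only [Pi.single_neg]
    abel
  rw [increment, h]

lemma increment_target_eq (d : α → ℤ) (u v u' : α) :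
    increment d u v u' v = l1 (d + Pi.single u' 1 + Pi.single u (-1)) - l1 d := by
  have h : d + Pi.single v 1 + Pi.single u (-1) + Pi.single u' 1 + Pi.single v (-1) =
      d + Pi.single u' 1 + Pi.single u (-1) := by
    simp only [Pi.single_neg]
    abel
  rw [increment, h]

lemma increment_self (d : α → ℤ) (u v : α) : increment d u v u v = 0 := by
  have h : d + Pi.single v 1 + Pi.single v (-1) = d := by
    simp only [Pi.single_neg]
    abel
  rw [increment_source_eq, h, sub_self]

lemma increment_le_two (d : α → ℤ) (u v v' : α) : increment d u v u v' ≤ 2 := by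
  have := l1_transfer_le_two d v v'
  rw [increment_source_eq]
  linarith

lemma increment_nonpos (d : α → ℤ) {u u' : α} (v v' : α) (hu : 0 < d u) (hu' : d u' < 0) :
    increment d u v u' v' ≤ 0 := by
  have h : d + Pi.single v 1 + Pi.single u (-1) + Pi.single u' 1 + Pi.single v' (-1) =
      d + Pi.single u' 1 + Pi.single u (-1) + Pi.single v 1 + Pi.single v' (-1) := by
    abel
  have h1 := l1_transfer_of_neg_of_pos d hu' hu
  have h2 := l1_transfer_le_two (d + Pi.single u' 1 + Pi.single u (-1)) v v'
  rw [increment, h]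
  linarith

end Change

section Drift

variable {I : Type*} [Fintype I]

/-- The total drift is nonpositive when the unmatched sites `U`, the common block `C` and the
remaining sites contribute suitably. -/
lemma drift_sum_nonpos (C U : Finset I) (hCU : Disjoint C U) (k : ℕ)
    (hI : Fintype.card I ≤ C.card + k) (F : I → I → ℤ)
    (hUC : ∀ i ∈ U, ∀ j ∈ C, F i j ≤ -2) (hU : ∀ i ∈ U, ∀ j, F i j ≤ 0)
    (hRU : ∀ i, i ∉ U → i ∉ C → ∀ j ∈ U, F i j ≤ 2)
    (hR : ∀ i, i ∉ U → i ∉ C → ∀ j, j ∉ U → F i j ≤ 0)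
    (hCR : ∀ i ∈ C, ∀ j, j ∉ U → j ∉ C → F i j ≤ 0)
    (hCC : ∀ i ∈ C, ∑ j ∈ C, F i j ≤ 0)
    (hsum : ∀ j ∈ U, ∑ i ∈ C, F i j ≤ 2 * ((C.card : ℤ) - k)) :
    ∑ i, ∑ j, F i j ≤ 0 := by
  let R := Finset.univ \ (C ∪ U)
  have hR_mem : ∀ i, i ∈ R ↔ i ∉ C ∧ i ∉ U := fun i => by simp [R]
  have split : ∀ h : I → ℤ, ∑ i, h i = ∑ i ∈ C, h i + ∑ i ∈ U, h i + ∑ i ∈ R, h i := by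
    intro h
    rw [← Finset.sum_union hCU, add_comm, Finset.sum_sdiff (Finset.subset_univ _)]
  have hcard : (R.card : ℤ) ≤ k := by
    have h1 := split fun _ => 1
    simp only [Finset.sum_const, Finset.card_univ, nsmul_eq_mul, mul_one] at h1
    have h2 : (Fintype.card I : ℤ) ≤ C.card + k := by exact_mod_cast hI
    have h3 : (0 : ℤ) ≤ U.card := by positivity
    linarith
  have hCsum : ∑ i ∈ C, ∑ j, F i j ≤ U.card * (2 * ((C.card : ℤ) - k)) := by
    calc ∑ i ∈ C, ∑ j, F i j ≤ ∑ i ∈ C, ∑ j ∈ U, F i j := by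
          refine Finset.sum_le_sum fun i hi => ?_
          have h1 : ∑ j ∈ R, F i j ≤ 0 := Finset.sum_nonpos fun j hj =>
            hCR i hi j ((hR_mem j).1 hj).2 ((hR_mem j).1 hj).1
          have h2 := hCC i hi
          rw [split]
          linarith
      _ = ∑ j ∈ U, ∑ i ∈ C, F i j := Finset.sum_comm
      _ ≤ U.card * (2 * ((C.card : ℤ) - k)) := by
          rw [← nsmul_eq_mul]
          exact Finset.sum_le_card_nsmul _ _ _ hsum
  have hUsum : ∑ i ∈ U, ∑ j, F i j ≤ U.card * (C.card * (-2)) := by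
    rw [← nsmul_eq_mul]
    refine Finset.sum_le_card_nsmul _ _ _ fun i hi => ?_
    have h1 : ∑ j ∈ C, F i j ≤ C.card * (-2) := by
      rw [← nsmul_eq_mul]
      exact Finset.sum_le_card_nsmul _ _ _ (hUC i hi)
    have h2 : ∑ j ∈ U, F i j ≤ 0 := Finset.sum_nonpos fun j _ => hU i hi j
    have h3 : ∑ j ∈ R, F i j ≤ 0 := Finset.sum_nonpos fun j _ => hU i hi j
    rw [split]
    linarith
  have hRsum : ∑ i ∈ R, ∑ j, F i j ≤ R.card * (U.card * 2) := by
    rw [← nsmul_eq_mul]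
    refine Finset.sum_le_card_nsmul _ _ _ fun i hi => ?_
    obtain ⟨hiC, hiU⟩ := (hR_mem i).1 hi
    have h1 : ∑ j ∈ U, F i j ≤ U.card * 2 := by
      rw [← nsmul_eq_mul]
      exact Finset.sum_le_card_nsmul _ _ _ (hRU i hiU hiC)
    have h2 : ∑ j ∈ C, F i j ≤ 0 := Finset.sum_nonpos fun j hj =>
      hR i hiU hiC j (Finset.disjoint_left.1 hCU hj)
    have h3 : ∑ j ∈ R, F i j ≤ 0 := Finset.sum_nonpos fun j hj =>
      hR i hiU hiC j ((hR_mem j).1 hj).2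
    rw [split]
    linarith
  have h4 : (R.card : ℤ) * (U.card * 2) ≤ k * (U.card * 2) :=
    mul_le_mul_of_nonneg_right hcard (by positivity)
  rw [split]
  linarith

end Drift

section Block

variable {I : Type*}

/-- If every label occurs at least `k` times among the sites satisfying `M`, then `k` such sites
can be selected for every label simultaneously. -/
lemma exists_block {T : Type*} [Fintype I] (k : ℕ) (f : I → T) (M : I → Prop)
    (h : ∀ c, k ≤ (Finset.univ.filter fun i => f i = c ∧ M i).card) :
    ∃ e : T × Fin k ↪ I, ∀ p, f (e p) = p.1 ∧ M (e p) := by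
  have hex : ∀ c, Nonempty (Fin k ↪ {i // f i = c ∧ M i}) := fun c =>
    Function.Embedding.nonempty_of_card_le (by
      rw [Fintype.card_fin, Fintype.card_subtype]
      exact h c)
  let e c := (hex c).some
  refine ⟨⟨fun p => (e p.1 p.2).1, ?_⟩, fun p => (e p.1 p.2).2⟩
  rintro ⟨c, l⟩ ⟨c', l'⟩ h
  have hc : c = c' := by
    rw [← (e c l).2.1, ← (e c' l').2.1]
    exact congrArg f h
  subst hc
  exact congrArg (Prod.mk c) ((e c).injective (Subtype.ext h))

/-- The permutation of `I` induced on a block by permutations `f x` of the second coordinate. -/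
def blockPerm {A B L : Type*} (e : (A × B) × L ↪ I) (f : A → Equiv.Perm B) : Equiv.Perm I :=
  Equiv.Perm.viaEmbedding (Equiv.prodCongr (Equiv.prodCongrRight f) (Equiv.refl L)) e

lemma blockPerm_apply {A B L : Type*} (e : (A × B) × L ↪ I) (f : A → Equiv.Perm B)
    (x : A) (v : B) (l : L) : blockPerm e f (e ((x, v), l)) = e ((x, f x v), l) :=
  Equiv.Perm.viaEmbedding_apply _ e _

lemma blockPerm_apply_of_notMem {A B L : Type*} (e : (A × B) × L ↪ I) (f : A → Equiv.Perm B)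
    {i : I} (hi : i ∉ Set.range e) : blockPerm e f i = i :=
  Equiv.Perm.viaEmbedding_apply_of_notMem _ e _ hi

/-- Permutations of the sites that compensate for the mismatch at sites in `U`, and that
exchange the values `1` and `g` for moves of positive sign at block sites of label `c`. -/
lemma exists_rotations {G : Type} {L : Type*} [Group G] (e : (G × G) × L ↪ I) (s t : I → G)
    (hs : ∀ p, s (e p) = p.1.2) (ht : ∀ p, t (e p) = p.1.2) (U : I → Prop)
    (hU : ∀ p, ¬ U (e p)) (g : G) (c : G × G) :
    ∃ ρ : I → Bool → Equiv.Perm I, (∀ i ε, ρ i ε i = i) ∧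
      (∀ i ε j, j ∉ Set.range e → ρ i ε j = j) ∧
      (∀ i ε p, U i →
        s i * signed ε (s (e p)) = t i * signed ε (t (ρ i ε (e p)))) ∧
      (∀ i ε, ¬ U i → ¬ (ε = true ∧ ∃ l, e (c, l) = i) → ρ i ε = 1) ∧
      ∀ l x v l', ρ (e (c, l)) true (e ((x, v), l')) =
        e ((x, if x = c.1 then v else Equiv.swap 1 g v), l') := by
  let ψ : I → Bool → Equiv.Perm G := fun i ε =>
    if ε then Equiv.mulLeft ((t i)⁻¹ * s i) else Equiv.mulRight ((s i)⁻¹ * t i)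
  let τ : G → Equiv.Perm G := fun x => if x = c.1 then 1 else Equiv.swap 1 g
  have hτ : ∀ x v, τ x v = if x = c.1 then v else Equiv.swap 1 g v := by
    intro x v
    simp only [τ]
    split_ifs <;> rfl
  refine ⟨fun i ε => if U i then blockPerm e fun _ => ψ i ε else
    if ε = true ∧ ∃ l, e (c, l) = i then blockPerm e τ else 1, ?_, ?_, ?_, ?_, ?_⟩
  · intro i ε
    dsimp only
    split_ifs with h1 h2
    · refine blockPerm_apply_of_notMem e _ ?_
      rintro ⟨p, rfl⟩
      exact hU p h1
    · obtain ⟨-, l, rfl⟩ := h2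
      exact (blockPerm_apply e τ c.1 c.2 l).trans (by simp [hτ])
    · rfl
  · intro i ε j hj
    dsimp only
    split_ifs
    · exact blockPerm_apply_of_notMem e _ hj
    · exact blockPerm_apply_of_notMem e _ hj
    · rfl
  · rintro i ε ⟨⟨x, v⟩, l⟩ hi
    simp only [hi, if_true, blockPerm_apply, hs, ht]
    cases ε <;> simp [ψ, signed, mul_assoc]
  · intro i ε h1 h2
    simp only [h1, h2, if_false]
  · intro l x v l'
    dsimp only
    rw [if_neg (hU _), if_pos ⟨rfl, l, rfl⟩, blockPerm_apply, hτ]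

end Block

section Coupling

variable {G : Type} [Group G] [Fintype G] {n : ℕ}

lemma exists_move_coupling (σast s st : Config G n) (k : ℕ)
    (hs : ∀ a b, k ≤ nab G σast s a b) (hst : ∀ a b, k ≤ nab G σast st a b)
    (hn : n ≤ Fintype.card G * Fintype.card G * k + k) (hD : imbalance σast s st ≠ 0) :
    ∃ Φ : Equiv.Perm (Move n),
      ∑ m, (l1 (imbalance σast (applyMove G s m) (applyMove G st (Φ m))) -
        l1 (imbalance σast s st)) ≤ 0 ∧
      k * k * Fintype.card G ≤ (Finset.univ.filter fun m : Move n =>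
        l1 (imbalance σast (applyMove G s m) (applyMove G st (Φ m))) ≠
          l1 (imbalance σast s st)).card := by
  obtain ⟨φ, hφ, hmatch⟩ := exists_matching σast s st
  set d := imbalance σast s st with hd
  let t : Fin n → G := fun i => st (φ i)
  have hpos : ∀ i, s i ≠ t i → 0 < d (σast i, s i) := by
    intro i hi
    have := (hmatch i hi).1
    simp only [hd, imbalance, nab]
    omega
  have hneg : ∀ i, s i ≠ t i → d (σast i, t i) < 0 := by
    intro i hi
    have := (hmatch i hi).2
    simp only [hd, imbalance, nab, t]
    omega
  have hnab_t : ∀ a b, nab G σast st a b = nab G σast t a b := by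
    intro a b
    exact (Finset.card_equiv φ (by simp [t, hφ])).symm
  obtain ⟨e, he⟩ : ∃ e : (G × G) × Fin k ↪ Fin n,
      ∀ p, (σast (e p), s (e p)) = p.1 ∧ s (e p) = t (e p) := by
    refine exists_block k (fun i => (σast i, s i)) (fun i => s i = t i) fun c => ?_
    by_cases hc : ∃ i, σast i = c.1 ∧ s i = c.2 ∧ s i ≠ t i
    · obtain ⟨i, hi1, hi2, hi⟩ := hc
      refine (hst c.1 c.2).trans ?_
      rw [hnab_t]
      refine Finset.card_le_card fun j hj => ?_
      simp only [Finset.mem_filter, Finset.mem_univ, true_and] at hj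
      have hj' : s j = t j := by
        by_contra hne
        have h1 := hneg j hne
        have h2 := hpos i hi
        rw [hj.1, hj.2] at h1
        rw [hi1, hi2] at h2
        exact h1.not_gt h2
      simp [Prod.ext_iff, hj', hj.1, hj.2]
    · push Not at hc
      refine (hs c.1 c.2).trans (Finset.card_le_card fun j hj => ?_)
      simp only [Finset.mem_filter, Finset.mem_univ, true_and] at hj
      have hj' := hc j hj.1 hj.2
      simp [Prod.ext_iff, ← hj', hj.1, hj.2]
  have hea : ∀ p, σast (e p) = p.1.1 := fun p => congrArg Prod.fst (he p).1
  have hes : ∀ p, s (e p) = p.1.2 := fun p => congrArg Prod.snd (he p).1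
  have het : ∀ p, t (e p) = p.1.2 := fun p => (he p).2.symm.trans (hes p)
  obtain ⟨i₀, hi₀⟩ : ∃ i, s i ≠ t i := by
    by_contra! h
    refine hD (funext fun c => ?_)
    have : s = t := funext h
    simp [hd, imbalance, hnab_t, this]
  obtain ⟨a, ha⟩ : ∃ a, a = σast i₀ := ⟨_, rfl⟩
  obtain ⟨b, hb⟩ : ∃ b, b = s i₀ := ⟨_, rfl⟩
  obtain ⟨b', hb'⟩ : ∃ b', b' = t i₀ := ⟨_, rfl⟩
  have hdb : 0 < d (a, b) := by rw [ha, hb]; exact hpos i₀ hi₀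
  have hdb' : d (a, b') < 0 := by rw [ha, hb']; exact hneg i₀ hi₀
  have hbb' : b ≠ b' := by rw [hb, hb']; exact hi₀
  have hg1 : b⁻¹ * b' ≠ 1 := fun h => hbb' (inv_mul_eq_one.1 h)
  obtain ⟨ρ, hρ_self, hρ_out, hρ_U, hρ_one, hρ_swap⟩ := exists_rotations e s t hes het
    (fun i => s i ≠ t i) (fun p => by simp [hes, het]) (b⁻¹ * b') (a, b)
  let F : Bool → Fin n → Fin n → ℤ := fun ε i j =>
    increment d (σast i, s i) (σast i, s i * signed ε (s j))
      (σast i, t i) (σast i, t i * signed ε (t (ρ i ε j)))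
  let Φ : Equiv.Perm (Move n) := Equiv.ofBijective (relabelMove φ ρ hρ_self)
    (Finite.injective_iff_bijective.1 (relabelMove_injective φ ρ hρ_self))
  have hF : ∀ m, l1 (imbalance σast (applyMove G s m) (applyMove G st (Φ m))) - l1 d =
      F m.2 m.1.1.1 m.1.1.2 := by
    intro m
    rw [imbalance_applyMove σast s st m (Φ m) (hφ _)]
    rfl
  have hF_one : ∀ ε i j, s i = t i → s j = t (ρ i ε j) → F ε i j = 0 := by
    intro ε i j hi hj
    simp only [F, hi, ← hj, increment_self]
  have hF_swap : ∀ l x v l', F true (e ((a, b), l)) (e ((x, v), l')) =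
      if x = a then 0 else
        (Pi.single 1 2 + Pi.single (b⁻¹ * b') (-2) : G → ℤ) v := by
    intro l x v l'
    by_cases hx : x = a
    · rw [if_pos hx]
      refine hF_one _ _ _ (by rw [hes, het]) ?_
      rw [hρ_swap, hes, het]
      simp [hx]
    · rw [if_neg hx]
      simp only [F, hρ_swap, hes, het, hea, hx, if_false, increment_source_eq, signed, if_true]
      by_cases hv1 : v = 1
      · subst hv1
        rw [Equiv.swap_apply_left, mul_one, mul_inv_cancel_left,
          l1_transfer_of_pos_of_neg d hdb hdb']
        simp [Pi.single_eq_of_ne hg1.symm]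
      by_cases hvg : v = b⁻¹ * b'
      · subst hvg
        rw [Equiv.swap_apply_right, mul_one, mul_inv_cancel_left,
          l1_transfer_of_neg_of_pos d hdb' hdb]
        simp [Pi.single_eq_of_ne hg1]
      · rw [Equiv.swap_apply_of_ne_of_ne hv1 hvg]
        simp only [Pi.single_neg]
        simp [Pi.single_eq_of_ne hv1, Pi.single_eq_of_ne hvg]
  refine ⟨Φ, ?_, ?_⟩
  · simp only [hF]
    rw [sum_move (fun i j ε => F ε i j)]
    refine Finset.sum_nonpos fun ε _ => ?_
    let C : Finset (Fin n) := Finset.univ.map e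
    let U : Finset (Fin n) := Finset.univ.filter fun i => s i ≠ t i
    have hmemU : ∀ i, i ∈ U ↔ s i ≠ t i := fun i => by simp [U]
    have hmemC : ∀ i, i ∈ C ↔ ∃ p, e p = i := fun i => by simp [C]
    have hCU : Disjoint C U := by
      rw [Finset.disjoint_left]
      intro i hC hU
      obtain ⟨p, rfl⟩ := (hmemC i).1 hC
      exact (hmemU _).1 hU (he p).2
    have hC : C.card = Fintype.card G * Fintype.card G * k := by simp [C]
    refine drift_sum_nonpos C U hCU k (by rw [Fintype.card_fin, hC]; exact hn) _
      ?_ ?_ ?_ ?_ ?_ ?_ ?_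
    · intro i hi j hj
      have hij : i ≠ j := fun h => Finset.disjoint_left.1 hCU hj (h ▸ hi)
      obtain ⟨p, rfl⟩ := (hmemC j).1 hj
      rw [hmemU] at hi
      simp only [hij, if_false, F, ← hρ_U i ε p hi, increment_target_eq,
        l1_transfer_of_neg_of_pos d (hneg i hi) (hpos i hi)]
      linarith
    · intro i hi j
      rw [hmemU] at hi
      split_ifs
      · rfl
      · exact increment_nonpos d _ _ (hpos i hi) (hneg i hi)
    · intro i hi _ j _
      have hi' : s i = t i := by simpa [hmemU] using hi
      split_ifs
      · norm_num
      · simp only [F, hi']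
        exact increment_le_two d _ _ _
    · intro i hi hiC j hj
      have hi' : s i = t i := by simpa [hmemU] using hi
      have hj' : s j = t j := by simpa [hmemU] using hj
      have h1 : ρ i ε = 1 := hρ_one i ε (by simpa using hi') (by
        rintro ⟨-, l, rfl⟩
        exact hiC ((hmemC _).2 ⟨_, rfl⟩))
      rw [hF_one ε i j hi' (by rw [h1]; exact hj'), ite_self]
    · intro i hi j hjU hjC
      obtain ⟨p, rfl⟩ := (hmemC i).1 hi
      have hj' : s j = t j := by simpa [hmemU] using hjU
      rw [hF_one ε _ j (he p).2 (by
        rw [hρ_out]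
        · exact hj'
        · simpa [hmemC] using hjC), ite_self]
    · intro i hi
      obtain ⟨p, rfl⟩ := (hmemC i).1 hi
      have hdiag : F ε (e p) (e p) = 0 := by
        refine hF_one ε _ _ (he p).2 ?_
        rw [hρ_self]
        exact (he p).2
      have hite : ∀ j, (if e p = j then 0 else F ε (e p) j) = F ε (e p) j := by
        intro j
        split_ifs with h
        · rw [← h, hdiag]
        · rfl
      simp only [hite, C, Finset.sum_map]
      by_cases hsp : ε = true ∧ ∃ l, e ((a, b), l) = e p
      · obtain ⟨rfl, l, hl⟩ := hsp
        simp only [← hl, Fintype.sum_prod_type, hF_swap]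
        refine Finset.sum_nonpos fun x _ => ?_
        rw [Finset.sum_comm]
        refine Finset.sum_nonpos fun l' _ => ?_
        split_ifs
        · simp
        · simp [Finset.sum_add_distrib]
      · refine Finset.sum_nonpos fun q _ => ?_
        have h1 : ρ (e p) ε = 1 := hρ_one _ ε (by simpa using (he p).2) hsp
        rw [hF_one ε _ _ (he p).2 (by rw [h1]; exact (he q).2)]
    · intro j hj
      have hjC : j ∉ Set.range e := fun ⟨p, hp⟩ =>
        Finset.disjoint_left.1 hCU ((hmemC j).2 ⟨p, hp⟩) hj
      have hbound : ∀ p : (G × G) × Fin k, (if e p = j then 0 else F ε (e p) j) ≤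
          (|d (p.1.1, p.1.2 * signed ε (s j)) + 1| - |d (p.1.1, p.1.2 * signed ε (s j))|) +
          (|d (p.1.1, p.1.2 * signed ε (t j)) - 1| -
            |d (p.1.1, p.1.2 * signed ε (t j))|) := by
        intro p
        rw [if_neg fun h => hjC ⟨p, h⟩]
        simp only [F, hes, het, hea, hρ_out _ ε j hjC, increment_source_eq]
        have := l1_transfer_le d (p.1.1, p.1.2 * signed ε (s j))
          (p.1.1, p.1.2 * signed ε (t j))
        linarith
      have hshift : ∀ (h : G) (f : G × G → ℤ), ∑ c : G × G, f (c.1, c.2 * h) = ∑ c, f c :=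
        fun h f => Equiv.sum_comp
          ((Equiv.refl G).prodCongr (Equiv.mulRight h)) f
      rw [Finset.sum_map]
      refine (Finset.sum_le_sum fun p _ => hbound p).trans ?_
      rw [Fintype.sum_prod_type_right]
      have hrow := sum_abs_second_difference_le d hdb.ne'
      rw [Finset.sum_add_distrib] at hrow
      simp only [Finset.sum_add_distrib, hshift _ fun c => |d c + 1| - |d c|,
        hshift _ fun c => |d c - 1| - |d c|, Finset.sum_const, Finset.card_univ,
        Fintype.card_fin, nsmul_eq_mul]
      rw [Fintype.card_prod] at hrow
      rw [hC]
      push_cast at hrow ⊢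
      nlinarith [mul_le_mul_of_nonneg_left hrow (Nat.cast_nonneg (α := ℤ) k)]
  · have hQ : 1 < Fintype.card G := Fintype.one_lt_card_iff.2 ⟨b, b', hbb'⟩
    let T := Fin k × {x : G // x ≠ a} × Bool × Fin k
    have hcard : Fintype.card T = k * ((Fintype.card G - 1) * (2 * k)) := by
      simp [T, Fintype.card_subtype_compl]
    have hne : ∀ (l l' : Fin k) (x : {x : G // x ≠ a}) (v : G),
        e ((a, b), l) ≠ e ((x.1, v), l') := by
      intro l l' x v h
      have := e.injective h
      simp only [Prod.mk.injEq] at this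
      exact x.2 this.1.1.symm
    let ι : T → Move n := fun q =>
      (⟨(e ((a, b), q.1), e ((q.2.1.1, if q.2.2.1 then 1 else b⁻¹ * b'), q.2.2.2)),
        hne _ _ _ _⟩, true)
    have hι : Function.Injective ι := by
      rintro ⟨l, x, v, l'⟩ ⟨m, y, w, m'⟩ h
      simp only [ι, Prod.mk.injEq, Subtype.mk.injEq, EmbeddingLike.apply_eq_iff_eq,
        and_true, true_and] at h
      obtain ⟨rfl, ⟨hxy, hvw⟩, rfl⟩ := h
      obtain rfl := Subtype.ext hxy
      cases v <;> cases w
      · rfl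
      · exact absurd (by simpa using hvw) hg1
      · exact absurd (by simpa using hvw.symm) hg1
      · rfl
    calc k * k * Fintype.card G ≤ k * k * ((Fintype.card G - 1) * 2) :=
          Nat.mul_le_mul_left _ (by omega)
      _ = Fintype.card T := by rw [hcard]; ring
      _ = (Finset.univ.image ι).card := by
          rw [Finset.card_image_of_injective _ hι, Finset.card_univ]
      _ ≤ _ := by
          refine Finset.card_le_card fun m hm => ?_
          obtain ⟨⟨l, x, v, l'⟩, -, rfl⟩ := Finset.mem_image.1 hm
          rw [Finset.mem_filter]
          refine ⟨Finset.mem_univ _, fun h => ?_⟩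
          have h0 := hF (ι (l, x, v, l'))
          rw [h, sub_self] at h0
          simp only [ι, hF_swap, x.2, if_false] at h0
          cases v
          · simp [Pi.single_eq_of_ne hg1] at h0
          · simp [Pi.single_eq_of_ne hg1.symm] at h0

end Coupling

end PR

/-- Lemma 4.1: fix `σ_* ∈ S` and `0 < δ ≤ 1/(2Q²)` with `(1−δ)n/Q²` an
integer.  For chains started at any `σ, σ̃`, there is a coupling (given by a Markovian
coupling kernel `K`) such that whenever both current proportion matrices lie in `M_δ` and
`D_t > 0`, the conditional drift of `D` is ≤ 0 and the conditional probability that `D`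
changes is at least `(1−δ)²/(4Q³)`. -/
theorem coupling_contraction_construction
    (G : Type) [Group G] [Fintype G] (n : ℕ) (σast : PR.Config G n)
    (hσast : σast ∈ PR.gens G n)
    (δ : ℝ) (hδ0 : 0 < δ) (hδ1 : δ ≤ 1 / (2 * (Fintype.card G : ℝ) ^ 2))
    (hint : ∃ k : ℕ, (k : ℝ) = (1 - δ) * n / (Fintype.card G : ℝ) ^ 2)
    (σ σt : PR.Config G n) (hσ : σ ∈ PR.gens G n) (hσt : σt ∈ PR.gens G n) :
    ∃ K, PR.IsCouplingKernel G K ∧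
      ∀ s st : PR.Config G n,
        (fun a b => PR.nab G σast s a b) ∈ PR.MSet G n δ →
        (fun a b => PR.nab G σast st a b) ∈ PR.MSet G n δ →
        0 < PR.Dfun G σast s st →
        (∑ q : PR.Config G n × PR.Config G n,
            K (s, st) q * (PR.Dfun G σast q.1 q.2 - PR.Dfun G σast s st)) ≤ 0 ∧
        (1 - δ) ^ 2 / (4 * (Fintype.card G : ℝ) ^ 3) ≤
          ∑ q ∈ Finset.univ.filter
              (fun q : PR.Config G n × PR.Config G n =>
                PR.Dfun G σast q.1 q.2 ≠ PR.Dfun G σast s st),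
            K (s, st) q := by
  obtain ⟨k, hk⟩ := hint
  have hQ : (1 : ℝ) ≤ Fintype.card G := by exact_mod_cast Fintype.card_pos
  have hQ2 : (0 : ℝ) < (Fintype.card G : ℝ) ^ 2 := by positivity
  rw [le_div_iff₀ (by positivity)] at hδ1
  have hδ2 : δ ≤ 1 / 2 := by nlinarith
  have hkQ : (k : ℝ) * (Fintype.card G : ℝ) ^ 2 = (1 - δ) * n := by
    rw [hk]
    field_simp
  have hn : n ≤ Fintype.card G * Fintype.card G * k + k := by
    have hδn : δ * n ≤ k := by
      rw [hk, le_div_iff₀ hQ2]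
      have hn0 : (0 : ℝ) ≤ n := by positivity
      nlinarith
    have : (n : ℝ) ≤ Fintype.card G * Fintype.card G * k + k := by nlinarith
    exact_mod_cast this
  have hΦ : ∀ p : PR.Config G n × PR.Config G n, ∃ Φ : Equiv.Perm (PR.Move n),
      (∀ a b, k ≤ PR.nab G σast p.1 a b) → (∀ a b, k ≤ PR.nab G σast p.2 a b) →
      PR.imbalance σast p.1 p.2 ≠ 0 →
      ∑ m, (PR.l1 (PR.imbalance σast (PR.applyMove G p.1 m) (PR.applyMove G p.2 (Φ m))) -
        PR.l1 (PR.imbalance σast p.1 p.2)) ≤ 0 ∧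
      k * k * Fintype.card G ≤ (Finset.univ.filter fun m : PR.Move n =>
        PR.l1 (PR.imbalance σast (PR.applyMove G p.1 m) (PR.applyMove G p.2 (Φ m))) ≠
          PR.l1 (PR.imbalance σast p.1 p.2)).card := by
    intro p
    by_cases h : (∀ a b, k ≤ PR.nab G σast p.1 a b) ∧ (∀ a b, k ≤ PR.nab G σast p.2 a b) ∧
        PR.imbalance σast p.1 p.2 ≠ 0
    · obtain ⟨Φ, hΦ⟩ := PR.exists_move_coupling σast p.1 p.2 k h.1 h.2.1 hn h.2.2
      exact ⟨Φ, fun _ _ _ => hΦ⟩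
    · exact ⟨1, fun h1 h2 h3 => absurd ⟨h1, h2, h3⟩ h⟩
  choose Φ hΦ using hΦ
  refine ⟨PR.moveKernel Φ, PR.isCouplingKernel_moveKernel Φ, fun s st hs hst hD => ?_⟩
  have hD' : PR.imbalance σast s st ≠ 0 := by
    intro h
    have h2 := PR.two_mul_Dfun σast s st
    rw [h] at h2
    simp [PR.l1] at h2
    linarith
  have hcount : ∀ {x : ℕ}, (1 - δ) * n / (Fintype.card G : ℝ) ^ 2 ≤ (x : ℝ) → k ≤ x := by
    intro x hx
    rw [← hk] at hx
    exact_mod_cast hx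
  obtain ⟨hdrift, hchange⟩ := hΦ (s, st) (fun a b => hcount (hs.1 a b))
    (fun a b => hcount (hst.1 a b)) hD'
  have hDl1 : ∀ s st : PR.Config G n,
      PR.Dfun G σast s st = (PR.l1 (PR.imbalance σast s st) : ℝ) / 2 := by
    intro s st
    rw [← PR.two_mul_Dfun]
    ring
  constructor
  · rw [PR.sum_moveKernel_mul Φ (s, st)
      (fun q => PR.Dfun G σast q.1 q.2 - PR.Dfun G σast s st)]
    refine div_nonpos_of_nonpos_of_nonneg ?_ (by positivity)
    simp only [hDl1, ← sub_div]
    rw [← Finset.sum_div]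
    refine div_nonpos_of_nonpos_of_nonneg ?_ (by norm_num)
    exact_mod_cast hdrift
  · rw [PR.sum_filter_moveKernel]
    simp only [hDl1, ne_eq, div_left_inj' (two_ne_zero' ℝ), Int.cast_inj]
    have hn0 : (0 : ℝ) < n := by
      rcases Nat.eq_zero_or_pos n with rfl | h
      · exact absurd (funext fun c => by simp [PR.imbalance, PR.nab]) hD'
      · exact_mod_cast h
    have hk0 : 0 < k := by
      have : (0 : ℝ) < k := by
        rw [hk]
        have : 0 < 1 - δ := by linarith
        positivity
      exact_mod_cast this
    have hmove0 : (0 : ℝ) < Fintype.card (PR.Move n) := by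
      have h1 : 0 < k * k * Fintype.card G := by
        have := Fintype.card_pos (α := G)
        positivity
      exact_mod_cast (h1.trans_le hchange).trans_le (Finset.card_le_univ _)
    have hmove : (Fintype.card (PR.Move n) : ℝ) ≤ n * n * 2 := by
      exact_mod_cast PR.card_move_le
    have hchange' : (k : ℝ) * k * Fintype.card G ≤ ((Finset.univ.filter fun m : PR.Move n =>
        ¬ PR.l1 (PR.imbalance σast (PR.applyMove G s m) (PR.applyMove G st (Φ (s, st) m))) =
          PR.l1 (PR.imbalance σast s st)).card : ℝ) := by
      exact_mod_cast hchange
    refine le_trans ?_ (div_le_div_of_nonneg_right hchange' hmove0.le)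
    have hle : (1 - δ) ^ 2 / (4 * (Fintype.card G : ℝ) ^ 3) ≤
        (k : ℝ) * k * Fintype.card G / (n * n * 2) := by
      rw [hk, div_le_div_iff₀ (by positivity) (by positivity)]
      field_simp
      nlinarith [sq_nonneg (1 - δ)]
    exact hle.trans (div_le_div_of_nonneg_left (by positivity) hmove0 hmove)
end
end

section
/- Let a_1,…,a_k be a fixed generating set of G, and let σ_★ ∈ S be the configuration with σ_★(i) = a_i for i ≤ k and σ_★(i) = id otherwise. Let T := ⌊n·log n − R·n⌋. Then for every R > 0, the product replacement chain started at σ_★ satisfies Pr_{σ_★}(n^{{id}}_non(σ_T) ≥ n/3) ≤ 4·Q²/R². -/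
open scoped BigOperators
open Filter

attribute [local instance] Classical.propDecidable

noncomputable section

namespace PR

lemma sum_move_second {n : ℕ} (h : Fin n → ℝ) :
    ∑ m : Move n, h m.1.1.2 = 2 * ((n : ℝ) - 1) * ∑ j, h j := by
  have key : ∑ p : {p : Fin n × Fin n // p.1 ≠ p.2}, h p.1.2 = ((n : ℝ) - 1) * ∑ j, h j := by
    rw [← Finset.sum_subtype (Finset.univ.filter fun p : Fin n × Fin n => p.1 ≠ p.2)
      (by simp) (fun p => h p.2), Finset.sum_filter, Fintype.sum_prod_type_right, Finset.mul_sum]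
    refine Finset.sum_congr rfl fun j _ => ?_
    have split : ∀ i : Fin n, (if i ≠ j then h j else 0) = h j - if i = j then h j else 0 := by
      intro i
      by_cases hij : i = j <;> simp [hij]
    simp only [split, Finset.sum_sub_distrib]
    simp
    ring
  rw [Fintype.sum_prod_type]
  simp only [Finset.sum_const, Finset.card_univ, Fintype.card_bool, nsmul_eq_mul]
  rw [← Finset.mul_sum, key]
  push_cast
  ring

lemma card_move (n : ℕ) : (Fintype.card (Move n) : ℝ) = 2 * ((n : ℝ) - 1) * n := by
  have h := sum_move_second (n := n) fun _ => 1
  simpa using h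

variable {G : Type} [Group G]

lemma nNonId_applyMove_le {n : ℕ} (τ : Config G n) (m : Move n) :
    (nNonId G (applyMove G τ m) : ℝ) ≤ nNonId G τ + if τ m.1.1.2 ≠ 1 then 1 else 0 := by
  by_cases hj : τ m.1.1.2 = 1
  · simp [applyMove, hj]
  · simp only [ne_eq, hj, not_false_eq_true, if_true]
    have hsub : (Finset.univ.filter fun i => applyMove G τ m i ≠ 1) ⊆
        insert m.1.1.1 (Finset.univ.filter fun i => τ i ≠ 1) := by
      intro i hi
      by_cases h : i = m.1.1.1
      · simp [h]
      · simpa [applyMove, Function.update_of_ne h, h] using hi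
    exact_mod_cast (Finset.card_le_card hsub).trans (Finset.card_insert_le _ _)

lemma nNonId_extend_le {n k : ℕ} (a : Fin k → G) :
    nNonId G (fun i : Fin n => if h : (i : ℕ) < k then a ⟨(i : ℕ), h⟩ else 1) ≤ k := by
  have hmaps : ∀ i ∈ Finset.univ.filter (fun i : Fin n =>
      (if h : (i : ℕ) < k then a ⟨(i : ℕ), h⟩ else 1) ≠ 1), (i : ℕ) ∈ Finset.range k := by
    intro i hi
    by_contra hik
    simp_all
  simpa [nNonId] using
    Finset.card_le_card_of_injOn (fun i : Fin n => (i : ℕ)) hmaps Fin.val_injective.injOn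

lemma step_nonneg {n : ℕ} (σ σ' : Config G n) : 0 ≤ step G σ σ' := by
  unfold step
  positivity

variable [Fintype G]

lemma law_nonneg {n : ℕ} (σ₀ : Config G n) (t : ℕ) (τ : Config G n) : 0 ≤ law G σ₀ t τ := by
  induction t generalizing τ with
  | zero => unfold law; split_ifs <;> norm_num
  | succ t ih => exact Finset.sum_nonneg fun ρ _ => mul_nonneg (ih ρ) (step_nonneg ρ τ)

lemma sum_step_mul {n : ℕ} (τ : Config G n) (f : Config G n → ℝ) :
    ∑ σ, step G τ σ * f σ = (∑ m : Move n, f (applyMove G τ m)) / Fintype.card (Move n) := by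
  rw [Finset.sum_div, ← Finset.sum_fiberwise Finset.univ (applyMove G τ)]
  refine Finset.sum_congr rfl fun σ _ => ?_
  have hconst : ∀ m ∈ Finset.univ.filter (fun m : Move n => applyMove G τ m = σ),
      f (applyMove G τ m) / Fintype.card (Move n) = f σ / Fintype.card (Move n) := by
    intro m hm
    rw [(Finset.mem_filter.1 hm).2]
  rw [Finset.sum_congr rfl hconst, Finset.sum_const, nsmul_eq_mul, step]
  ring

lemma sum_step_mul_nNonId_le {n : ℕ} (hn : 2 ≤ n) (τ : Config G n) :
    ∑ σ, step G τ σ * (nNonId G σ : ℝ) ≤ (1 + 1 / (n : ℝ)) * nNonId G τ := by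
  have hn' : (2 : ℝ) ≤ n := by exact_mod_cast hn
  have hn0 : (0 : ℝ) < n := by linarith
  have hn1 : (0 : ℝ) < (n : ℝ) - 1 := by linarith
  have hsum := Finset.sum_le_sum fun (m : Move n) (_ : m ∈ Finset.univ) => nNonId_applyMove_le τ m
  rw [Finset.sum_add_distrib, sum_move_second fun j => if τ j ≠ 1 then (1 : ℝ) else 0,
    Finset.sum_const, Finset.card_univ, nsmul_eq_mul, card_move, Finset.sum_boole] at hsum
  rw [sum_step_mul, card_move, div_le_iff₀ (by positivity)]
  refine hsum.trans_eq ?_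
  simp only [nNonId]
  field_simp

lemma sum_law_mul_nNonId_le {n : ℕ} (hn : 2 ≤ n) (σ₀ : Config G n) (t : ℕ) :
    ∑ τ, law G σ₀ t τ * (nNonId G τ : ℝ) ≤ (1 + 1 / (n : ℝ)) ^ t * nNonId G σ₀ := by
  induction t with
  | zero => simp [law]
  | succ t ih =>
    calc ∑ σ, law G σ₀ (t + 1) σ * (nNonId G σ : ℝ)
        = ∑ τ, law G σ₀ t τ * ∑ σ, step G τ σ * (nNonId G σ : ℝ) := by
          simp only [law, Finset.sum_mul, Finset.mul_sum]
          rw [Finset.sum_comm]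
          simp only [mul_assoc]
      _ ≤ ∑ τ, law G σ₀ t τ * ((1 + 1 / (n : ℝ)) * nNonId G τ) :=
          Finset.sum_le_sum fun τ _ =>
            mul_le_mul_of_nonneg_left (sum_step_mul_nNonId_le hn τ) (law_nonneg σ₀ t τ)
      _ = (1 + 1 / (n : ℝ)) * ∑ τ, law G σ₀ t τ * (nNonId G τ : ℝ) := by
          rw [Finset.mul_sum]
          exact Finset.sum_congr rfl fun τ _ => by ring
      _ ≤ (1 + 1 / (n : ℝ)) * ((1 + 1 / (n : ℝ)) ^ t * nNonId G σ₀) :=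
          mul_le_mul_of_nonneg_left ih (by positivity)
      _ = (1 + 1 / (n : ℝ)) ^ (t + 1) * nNonId G σ₀ := by ring

/-- Markov's inequality for the number of non-identity sites. -/
lemma mul_prob_nNonId_le {n : ℕ} (σ₀ : Config G n) (t : ℕ) (c : ℝ) :
    c * prob G σ₀ t {τ | c ≤ (nNonId G τ : ℝ)} ≤ ∑ τ, law G σ₀ t τ * (nNonId G τ : ℝ) := by
  rw [prob, Finset.mul_sum]
  calc _ ≤ ∑ τ ∈ Finset.univ.filter (fun τ => τ ∈ {τ : Config G n | c ≤ (nNonId G τ : ℝ)}),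
          law G σ₀ t τ * (nNonId G τ : ℝ) := by
        refine Finset.sum_le_sum fun τ hτ => ?_
        rw [mul_comm]
        exact mul_le_mul_of_nonneg_left (Finset.mem_filter.1 hτ).2 (law_nonneg σ₀ t τ)
    _ ≤ _ := Finset.sum_le_sum_of_subset_of_nonneg (Finset.filter_subset _ _)
        fun τ _ _ => mul_nonneg (law_nonneg σ₀ t τ) (Nat.cast_nonneg _)

end PR

lemma three_mul_sq_le_four_mul_exp {R : ℝ} (hR : 0 ≤ R) : 3 * R ^ 2 ≤ 4 * Real.exp R := by
  have hlin : R ≤ Real.exp (R / 2) := by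
    nlinarith [Real.exp_one_mul_le_exp (x := R / 2), Real.add_one_le_exp (1 : ℝ)]
  have hsq : Real.exp R = Real.exp (R / 2) ^ 2 := by
    rw [← Real.exp_nat_mul]
    ring_nf
  rw [hsq]
  nlinarith

/-- Lemma 5.1: let `a_1, …, a_k` be a fixed generating set of `G` and let
`σ_★` place `a_i` at site `i ≤ k` and the identity elsewhere.  With `T = ⌊n log n − Rn⌋`,
for all large enough `n` and every `R > 0`,
`Pr_{σ_★}(n^{id}_non(σ_T) ≥ n/3) ≤ 4Q²/R²`. -/
theorem burn_in_lower_bound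
    (G : Type) [Group G] [Fintype G] :
    ∃ N : ℕ, ∀ n : ℕ, N ≤ n →
      ∀ (k : ℕ) (a : Fin k → G), Function.Injective a →
        Subgroup.closure (Set.range a) = (⊤ : Subgroup G) → k ≤ n →
        ∀ R : ℝ, 0 < R →
          PR.prob G
            (fun i : Fin n => if h : (i : ℕ) < k then a ⟨(i : ℕ), h⟩ else 1)
            ⌊(n : ℝ) * Real.log n - R * n⌋₊
            {τ | (n : ℝ) / 3 ≤ (PR.nNonId G τ : ℝ)}
          ≤ 4 * (Fintype.card G : ℝ) ^ 2 / R ^ 2 := by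
  refine ⟨3 * Fintype.card G + 1, fun n hN k a ha _ _ R hR => ?_⟩
  have hkQ : k ≤ Fintype.card G := by
    simpa using Fintype.card_le_of_injective a ha
  have hQ : 1 ≤ Fintype.card G := Fintype.card_pos
  have hQ' : (1 : ℝ) ≤ Fintype.card G := by exact_mod_cast hQ
  have hn2 : 2 ≤ n := by omega
  have hn0 : (0 : ℝ) < n := by exact_mod_cast (by omega : 0 < n)
  set σ₀ : PR.Config G n := fun i => if h : (i : ℕ) < k then a ⟨(i : ℕ), h⟩ else 1
  have hσ₀ : PR.nNonId G σ₀ ≤ Fintype.card G := (PR.nNonId_extend_le a).trans hkQ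
  have hσ₀' : (PR.nNonId G σ₀ : ℝ) ≤ Fintype.card G := by exact_mod_cast hσ₀
  rcases le_total ((n : ℝ) * Real.log n - R * n) 0 with hT | hT
  · rw [Nat.floor_of_nonpos hT]
    have hzero : PR.prob G σ₀ 0 {τ | (n : ℝ) / 3 ≤ (PR.nNonId G τ : ℝ)} = 0 := by
      refine Finset.sum_eq_zero fun τ hτ => ?_
      have hτ' : (n : ℝ) / 3 ≤ (PR.nNonId G τ : ℝ) := (Finset.mem_filter.1 hτ).2
      refine if_neg fun h => ?_
      rw [h] at hτ'
      have hN' : (3 : ℝ) * Fintype.card G + 1 ≤ n := by exact_mod_cast hN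
      linarith
    rw [hzero]
    positivity
  · set T := ⌊(n : ℝ) * Real.log n - R * n⌋₊
    have hTle : (T : ℝ) ≤ n * Real.log n - R * n := Nat.floor_le hT
    have hpow : (1 + 1 / (n : ℝ)) ^ T * Real.exp R ≤ n := by
      calc (1 + 1 / (n : ℝ)) ^ T * Real.exp R
          ≤ Real.exp (1 / (n : ℝ)) ^ T * Real.exp R := by
            gcongr
            linarith [Real.add_one_le_exp (1 / (n : ℝ))]
        _ = Real.exp (T / n + R) := by
            rw [← Real.exp_nat_mul, ← Real.exp_add, mul_one_div]
        _ ≤ Real.exp (Real.log n) := by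
            refine Real.exp_le_exp.2 ?_
            have hdiv : (T : ℝ) / n ≤ Real.log n - R := by
              rw [div_le_iff₀ hn0]
              linarith
            linarith
        _ = n := Real.exp_log hn0
    have hmarkov := (PR.mul_prob_nNonId_le σ₀ T ((n : ℝ) / 3)).trans
      (PR.sum_law_mul_nNonId_le hn2 σ₀ T)
    set P := PR.prob G σ₀ T {τ | (n : ℝ) / 3 ≤ (PR.nNonId G τ : ℝ)}
    have hP0 : 0 ≤ P := Finset.sum_nonneg fun τ _ => PR.law_nonneg σ₀ T τ
    have hbound : P * Real.exp R ≤ 3 * Fintype.card G := by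
      refine le_of_mul_le_mul_left ?_ hn0
      calc (n : ℝ) * (P * Real.exp R) = 3 * ((n / 3 * P) * Real.exp R) := by ring
        _ ≤ 3 * (((1 + 1 / (n : ℝ)) ^ T * PR.nNonId G σ₀) * Real.exp R) := by gcongr
        _ = 3 * (((1 + 1 / (n : ℝ)) ^ T * Real.exp R) * PR.nNonId G σ₀) := by ring
        _ ≤ 3 * (n * Fintype.card G) := by gcongr
        _ = n * (3 * Fintype.card G) := by ring
    rw [le_div_iff₀ (by positivity)]
    have hexp := mul_le_mul_of_nonneg_left (three_mul_sq_le_four_mul_exp hR.le) hP0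
    nlinarith
end
end
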